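/- arXiv:1211.7325 — 3 statements merged into one kernel-verified Lean document; each statement's English description precedes it below -/
import Mathlib

section
/- For all real ν ≥ 1/2, every natural number n, and all x > 0, the repeated integrals satisfy I_{(ν,0,n+1)}(x) < I_{(ν,0,n)}(x). -/
open Real MeasureTheory

/-- The modified Bessel function of the first kind
`I_ν(x) = Σ_{k=0}^∞ (1/(k! Γ(k+ν+1))) (x/2)^{2k+ν}`. -/
noncomputable def besselI (ν x : ℝ) : ℝ :=
  ∑' k : ℕ, (1 / ((k.factorial : ℝ) * Real.Gamma ((k : ℝ) + ν + 1))) *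
    (x / 2) ^ (2 * (k : ℝ) + ν)

/-- The repeated integrals `I_{(ν,β,0)}(x) = e^{βx} x^ν I_ν(x)`,
`I_{(ν,β,n+1)}(x) = ∫_0^x I_{(ν,β,n)}(y) dy`. -/
noncomputable def besselIRep (ν β : ℝ) : ℕ → ℝ → ℝ
  | 0 => fun x => Real.exp (β * x) * x ^ ν * besselI ν x
  | n + 1 => fun x => ∫ y in (0 : ℝ)..x, besselIRep ν β n y

/-- The generalized power series `∑ a_k x^{2k+q}` with a real exponent offset `q`. -/
noncomputable def rpowSeries (a : ℕ → ℝ) (q x : ℝ) : ℝ :=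
  ∑' k : ℕ, a k * x ^ (2 * (k : ℝ) + q)

/-- The coefficient sequence `a` has infinite radius of convergence. -/
def EntireCoeff (a : ℕ → ℝ) : Prop :=
  ∀ r : ℝ, 0 ≤ r → Summable fun k => |a k| * r ^ k

lemma rpow_two_mul_natCast_add {x : ℝ} (hx : 0 < x) (k : ℕ) (q : ℝ) :
    x ^ (2 * (k : ℝ) + q) = (x ^ 2) ^ k * x ^ q := by
  rw [Real.rpow_add hx, ← pow_mul, ← Real.rpow_natCast]
  push_cast
  rfl

lemma EntireCoeff.summable_abs {a : ℕ → ℝ} (ha : EntireCoeff a) (q : ℝ) {x : ℝ} (hx : 0 < x) :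
    Summable fun k : ℕ => |a k| * x ^ (2 * (k : ℝ) + q) := by
  refine ((ha (x ^ 2) (by positivity)).mul_right (x ^ q)).congr fun k => ?_
  rw [rpow_two_mul_natCast_add hx, mul_assoc]

lemma EntireCoeff.summable {a : ℕ → ℝ} (ha : EntireCoeff a) (q : ℝ) {x : ℝ} (hx : 0 < x) :
    Summable fun k : ℕ => a k * x ^ (2 * (k : ℝ) + q) := by
  refine Summable.of_norm ((ha.summable_abs q hx).congr fun k => ?_)
  rw [Real.norm_eq_abs, abs_mul, abs_of_pos (Real.rpow_pos_of_pos hx _)]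

lemma EntireCoeff.mul_linear {a : ℕ → ℝ} (ha : EntireCoeff a) (q : ℝ) :
    EntireCoeff fun k => a k * (2 * (k : ℝ) + q) := by
  intro r hr
  refine Summable.of_nonneg_of_le (fun k => by positivity) (fun k => ?_)
    ((ha (2 * r) (by positivity)).mul_left (2 + |q|))
  have hk : (k : ℝ) ≤ 2 ^ k := by exact_mod_cast (Nat.lt_two_pow_self (n := k)).le
  have h1 : (1 : ℝ) ≤ 2 ^ k := one_le_pow₀ (by norm_num)
  have h2 : |2 * (k : ℝ) + q| ≤ (2 + |q|) * 2 ^ k := by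
    refine (abs_add_le _ _).trans ?_
    rw [abs_of_nonneg (by positivity : (0 : ℝ) ≤ 2 * k)]
    nlinarith [abs_nonneg q]
  calc |a k * (2 * (k : ℝ) + q)| * r ^ k = (|a k| * r ^ k) * |2 * (k : ℝ) + q| := by
        rw [abs_mul]; ring
    _ ≤ (|a k| * r ^ k) * ((2 + |q|) * 2 ^ k) := by gcongr
    _ = (2 + |q|) * (|a k| * (2 * r) ^ k) := by rw [mul_pow]; ring

lemma rpow_le_add_rpow {l u y : ℝ} (s : ℝ) (hl : 0 < l) (hly : l ≤ y) (hyu : y ≤ u) :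
    y ^ s ≤ l ^ s + u ^ s := by
  have hu : 0 < u := by linarith
  rcases le_total 0 s with hs | hs
  · have := Real.rpow_le_rpow (by linarith) hyu hs
    have := Real.rpow_pos_of_pos hl s
    linarith
  · have := Real.rpow_le_rpow_of_nonpos hl hly hs
    have := Real.rpow_pos_of_pos hu s
    linarith

lemma EntireCoeff.hasDerivAt_rpowSeries {a : ℕ → ℝ} (ha : EntireCoeff a) (q : ℝ) {x : ℝ}
    (hx : 0 < x) :
    HasDerivAt (rpowSeries a q)
      (rpowSeries (fun k => a k * (2 * (k : ℝ) + q)) (q - 1) x) x := by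
  have hb := ha.mul_linear q
  have hmem : x ∈ Set.Ioo (x / 2) (2 * x) := ⟨by linarith, by linarith⟩
  refine hasDerivAt_tsum_of_isPreconnected (t := Set.Ioo (x / 2) (2 * x))
    (g := fun (k : ℕ) y => a k * y ^ (2 * (k : ℝ) + q))
    (g' := fun (k : ℕ) y => a k * (2 * (k : ℝ) + q) * y ^ (2 * (k : ℝ) + (q - 1)))
    ((hb.summable_abs (q - 1) (half_pos hx)).add
      (hb.summable_abs (q - 1) (by linarith : 0 < 2 * x)))
    isOpen_Ioo isPreconnected_Ioo ?_ ?_ hmem (ha.summable q hx) hmem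
  · rintro k y ⟨hy, -⟩
    have hy0 : y ≠ 0 := by linarith
    have := (Real.hasDerivAt_rpow_const (p := 2 * (k : ℝ) + q) (Or.inl hy0)).const_mul (a k)
    rwa [← mul_assoc, add_sub_assoc] at this
  · rintro k y ⟨hy, hy'⟩
    rw [Real.norm_eq_abs, abs_mul,
      abs_of_pos (Real.rpow_pos_of_pos (by linarith : 0 < y) _), ← mul_add]
    exact mul_le_mul_of_nonneg_left
      (rpow_le_add_rpow _ (half_pos hx) hy.le hy'.le) (abs_nonneg _)

lemma EntireCoeff.continuousOn_rpowSeries {a : ℕ → ℝ} (ha : EntireCoeff a) {q : ℝ} (hq : 0 < q)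
    {R : ℝ} (hR : 0 < R) : ContinuousOn (rpowSeries a q) (Set.Icc 0 R) := by
  refine continuousOn_tsum (fun k => ?_) (ha.summable_abs q hR) ?_
  · exact continuousOn_const.mul
      (Real.continuous_rpow_const (by positivity)).continuousOn
  · rintro k y ⟨hy, hy'⟩
    rw [Real.norm_eq_abs, abs_mul, abs_of_nonneg (Real.rpow_nonneg hy _)]
    gcongr

/-- The coefficients of the expansion `x^ν I_ν(x) = ∑ a_k x^{2k+2ν}`. -/
noncomputable def besselCoeff (ν : ℝ) (k : ℕ) : ℝ :=
  1 / ((k.factorial : ℝ) * Real.Gamma ((k : ℝ) + ν + 1)) / 2 ^ (2 * (k : ℝ) + ν)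

lemma besselCoeff_pos {ν : ℝ} (hν : 0 ≤ ν) (k : ℕ) : 0 < besselCoeff ν k := by
  have := Real.Gamma_pos_of_pos (by positivity : 0 < (k : ℝ) + ν + 1)
  unfold besselCoeff
  positivity

lemma Gamma_le_Gamma_natCast_add {ν : ℝ} (hν : 0 ≤ ν) (k : ℕ) :
    Real.Gamma (ν + 1) ≤ Real.Gamma ((k : ℝ) + ν + 1) := by
  induction k with
  | zero => simp
  | succ k ih =>
    have hpos := Real.Gamma_pos_of_pos (by positivity : 0 < (k : ℝ) + ν + 1)
    have h : Real.Gamma (((k + 1 : ℕ) : ℝ) + ν + 1)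
        = ((k : ℝ) + ν + 1) * Real.Gamma ((k : ℝ) + ν + 1) := by
      rw [← Real.Gamma_add_one (by positivity)]
      push_cast
      congr 1
      ring
    rw [h]
    have hk : (0 : ℝ) ≤ k := k.cast_nonneg
    nlinarith

lemma entireCoeff_besselCoeff {ν : ℝ} (hν : 0 ≤ ν) : EntireCoeff (besselCoeff ν) := by
  intro r hr
  have hG := Real.Gamma_pos_of_pos (by positivity : 0 < ν + 1)
  refine Summable.of_nonneg_of_le (fun k => by positivity) (fun k => ?_)
    ((Real.summable_pow_div_factorial r).mul_left (1 / Real.Gamma (ν + 1)))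
  rw [abs_of_pos (besselCoeff_pos hν k)]
  have h2 : (1 : ℝ) ≤ 2 ^ (2 * (k : ℝ) + ν) :=
    Real.one_le_rpow (by norm_num) (by positivity)
  have hGk := Gamma_le_Gamma_natCast_add hν k
  have hc : besselCoeff ν k ≤ 1 / ((k.factorial : ℝ) * Real.Gamma (ν + 1)) := by
    unfold besselCoeff
    refine (div_le_self ?_ h2).trans ?_
    · have := hG.trans_le hGk
      positivity
    · gcongr
  calc besselCoeff ν k * r ^ k
      ≤ 1 / ((k.factorial : ℝ) * Real.Gamma (ν + 1)) * r ^ k := by gcongr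
    _ = 1 / Real.Gamma (ν + 1) * (r ^ k / (k.factorial : ℝ)) := by
        field_simp

lemma besselCoeff_succ {ν : ℝ} (hν : 0 ≤ ν) (k : ℕ) :
    besselCoeff ν (k + 1) * (4 * ((k : ℝ) + 1) * ((k : ℝ) + 1 + ν)) = besselCoeff ν k := by
  have hpos := Real.Gamma_pos_of_pos (by positivity : 0 < (k : ℝ) + ν + 1)
  have h : Real.Gamma (((k + 1 : ℕ) : ℝ) + ν + 1)
      = ((k : ℝ) + ν + 1) * Real.Gamma ((k : ℝ) + ν + 1) := by
    rw [← Real.Gamma_add_one (by positivity)]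
    push_cast
    congr 1
    ring
  have h2 : (2 : ℝ) ^ (2 * ((k + 1 : ℕ) : ℝ) + ν) = 4 * 2 ^ (2 * (k : ℝ) + ν) := by
    rw [show 2 * ((k + 1 : ℕ) : ℝ) + ν = (2 : ℕ) + (2 * (k : ℝ) + ν) by push_cast; ring,
      Real.rpow_add (by norm_num), Real.rpow_natCast]
    norm_num
  have h3 : (k : ℝ) + 1 + ν = (k : ℝ) + ν + 1 := by ring
  have h4 : (k : ℝ) + ν + 1 ≠ 0 := by positivity
  unfold besselCoeff
  rw [h, h2, Nat.factorial_succ, h3]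
  push_cast
  field_simp

lemma besselIRep_zero_eq_rpowSeries {ν : ℝ} (hν : 0 < ν) {x : ℝ} (hx : 0 ≤ x) :
    besselIRep ν 0 0 x = rpowSeries (besselCoeff ν) (2 * ν) x := by
  simp only [besselIRep, besselI, rpowSeries, zero_mul, Real.exp_zero, one_mul]
  rw [← tsum_mul_left]
  refine tsum_congr fun k => ?_
  have h : x ^ (2 * (k : ℝ) + 2 * ν) = x ^ ν * x ^ (2 * (k : ℝ) + ν) := by
    rw [← Real.rpow_add_of_nonneg hx (by positivity) (by positivity)]
    congr 1
    ring
  rw [h, Real.div_rpow hx (by norm_num), besselCoeff]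
  ring

/-- For `ν ≥ 1/2` the function `f(x) = x^ν I_ν(x)` satisfies `f ≤ f''` on `(0, ∞)`. -/
lemma rpowSeries_besselCoeff_le_second_deriv {ν : ℝ} (hν : 1 / 2 ≤ ν) {x : ℝ} (hx : 0 < x) :
    rpowSeries (besselCoeff ν) (2 * ν) x ≤
      rpowSeries (fun k => besselCoeff ν k * (2 * (k : ℝ) + 2 * ν) * (2 * (k : ℝ) + (2 * ν - 1)))
        (2 * ν - 1 - 1) x := by
  have hν0 : 0 ≤ ν := by linarith
  have ha := entireCoeff_besselCoeff hν0
  have hs := ((ha.mul_linear (2 * ν)).mul_linear (2 * ν - 1)).summable (2 * ν - 1 - 1) hx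
  unfold rpowSeries
  rw [hs.tsum_eq_zero_add]
  have h0 := besselCoeff_pos hν0 0
  have hx0 := Real.rpow_pos_of_pos hx (2 * ((0 : ℕ) : ℝ) + (2 * ν - 1 - 1))
  refine le_add_of_nonneg_of_le ?_ ((ha.summable (2 * ν) hx).tsum_le_tsum (fun k => ?_)
    ((summable_nat_add_iff 1).2 hs))
  · refine mul_nonneg (mul_nonneg (mul_nonneg h0.le (by positivity)) ?_) hx0.le
    push_cast
    linarith
  · have he : 2 * ((k + 1 : ℕ) : ℝ) + (2 * ν - 1 - 1) = 2 * (k : ℝ) + 2 * ν := by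
      push_cast
      ring
    rw [he]
    refine mul_le_mul_of_nonneg_right ?_ (Real.rpow_nonneg hx.le _)
    rw [← besselCoeff_succ hν0 k]
    have hp := besselCoeff_pos hν0 (k + 1)
    push_cast
    rw [mul_assoc (besselCoeff ν (k + 1))]
    refine mul_le_mul_of_nonneg_left ?_ hp.le
    have hk : (0 : ℝ) ≤ k := k.cast_nonneg
    nlinarith

lemma rpowSeries_besselCoeff_lt_deriv_of_lt_one {ν : ℝ} (hν : 1 / 2 ≤ ν) {x : ℝ} (hx : 0 < x)
    (hx1 : x < 1) :
    rpowSeries (besselCoeff ν) (2 * ν) x <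
      rpowSeries (fun k => besselCoeff ν k * (2 * (k : ℝ) + 2 * ν)) (2 * ν - 1) x := by
  have hν0 : 0 ≤ ν := by linarith
  have ha := entireCoeff_besselCoeff hν0
  have key : ∀ k : ℕ, besselCoeff ν k * x ^ (2 * (k : ℝ) + 2 * ν) <
      besselCoeff ν k * (2 * (k : ℝ) + 2 * ν) * x ^ (2 * (k : ℝ) + (2 * ν - 1)) := by
    intro k
    have he : x ^ (2 * (k : ℝ) + 2 * ν) = x * x ^ (2 * (k : ℝ) + (2 * ν - 1)) := by
      rw [← Real.rpow_one_add' hx.le (by nlinarith [k.cast_nonneg (α := ℝ)])]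
      congr 1
      ring
    have hk : (0 : ℝ) ≤ k := k.cast_nonneg
    rw [he, ← mul_assoc]
    refine mul_lt_mul_of_pos_right ?_ (Real.rpow_pos_of_pos hx _)
    exact mul_lt_mul_of_pos_left (by linarith) (besselCoeff_pos hν0 k)
  exact Summable.tsum_lt_tsum (i := 0) (fun k => (key k).le) (key 0) (ha.summable _ hx)
    ((ha.mul_linear _).summable _ hx)

/-- For `ν ≥ 1/2` the function `f(x) = x^ν I_ν(x)` satisfies `f < f'` on `(0, ∞)`. -/
lemma rpowSeries_besselCoeff_lt_deriv {ν : ℝ} (hν : 1 / 2 ≤ ν) {x : ℝ} (hx : 0 < x) :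
    rpowSeries (besselCoeff ν) (2 * ν) x <
      rpowSeries (fun k => besselCoeff ν k * (2 * (k : ℝ) + 2 * ν)) (2 * ν - 1) x := by
  have ha := entireCoeff_besselCoeff (by linarith : 0 ≤ ν)
  set f := rpowSeries (besselCoeff ν) (2 * ν)
  set f' := rpowSeries (fun k => besselCoeff ν k * (2 * (k : ℝ) + 2 * ν)) (2 * ν - 1)
  have hderiv : ∀ y ∈ Set.Ioi (0 : ℝ), HasDerivAt (fun y => Real.exp y * (f' y - f y)) _ y :=
    fun y hy => (Real.hasDerivAt_exp y).mul
      (((ha.mul_linear (2 * ν)).hasDerivAt_rpowSeries (2 * ν - 1) hy).sub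
        (ha.hasDerivAt_rpowSeries (2 * ν) hy))
  have hmono : MonotoneOn (fun y => Real.exp y * (f' y - f y)) (Set.Ioi 0) := by
    refine monotoneOn_of_deriv_nonneg (convex_Ioi 0)
      (fun y hy => (hderiv y hy).continuousAt.continuousWithinAt) ?_ ?_
    · rw [interior_Ioi]
      exact fun y hy => (hderiv y hy).differentiableAt.differentiableWithinAt
    · rw [interior_Ioi]
      intro y hy
      rw [(hderiv y hy).deriv, ← mul_add]
      refine mul_nonneg (Real.exp_pos y).le ?_
      have := rpowSeries_besselCoeff_le_second_deriv hν hy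
      simp only [f, f']
      linarith
  have hm : 0 < min x (1 / 2) := lt_min hx (by norm_num)
  have hle := hmono hm hx (min_le_left x (1 / 2))
  have hlt := rpowSeries_besselCoeff_lt_deriv_of_lt_one hν hm
    ((min_le_right x (1 / 2)).trans_lt (by norm_num))
  have hpos : 0 < Real.exp x * (f' x - f x) :=
    (mul_pos (Real.exp_pos _) (sub_pos.2 hlt)).trans_le hle
  exact sub_pos.1 (pos_of_mul_pos_right hpos (Real.exp_pos x).le)

lemma continuousOn_besselIRep {ν : ℝ} (hν : 0 < ν) (n : ℕ) {R : ℝ} (hR : 0 < R) :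
    ContinuousOn (besselIRep ν 0 n) (Set.Icc 0 R) := by
  induction n with
  | zero =>
    exact ((entireCoeff_besselCoeff hν.le).continuousOn_rpowSeries (by positivity) hR).congr
      fun y hy => besselIRep_zero_eq_rpowSeries hν hy.1
  | succ n ih =>
    have := intervalIntegral.continuousOn_primitive_interval (a := 0) (b := R) (μ := volume)
      (f := besselIRep ν 0 n) (by rw [Set.uIcc_of_le hR.le]; exact ih.integrableOn_Icc)
    rwa [Set.uIcc_of_le hR.le] at this

lemma besselIRep_one_lt {ν : ℝ} (hν : 1 / 2 ≤ ν) {x : ℝ} (hx : 0 < x) :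
    besselIRep ν 0 1 x < besselIRep ν 0 0 x := by
  have hν0 : 0 < ν := by linarith
  have ha := entireCoeff_besselCoeff hν0.le
  have hc (n : ℕ) := continuousOn_besselIRep hν0 n hx
  have hderiv : ∀ y ∈ Set.Ioo 0 x,
      HasDerivAt (fun y => besselIRep ν 0 0 y - besselIRep ν 0 1 y)
        (rpowSeries (fun k => besselCoeff ν k * (2 * (k : ℝ) + 2 * ν)) (2 * ν - 1) y
          - besselIRep ν 0 0 y) y := by
    intro y hy
    refine HasDerivAt.sub ((ha.hasDerivAt_rpowSeries (2 * ν) hy.1).congr_of_eventuallyEq ?_)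
      (intervalIntegral.integral_hasDerivAt_right (f := besselIRep ν 0 0) ?_ ?_ ?_)
    · filter_upwards [Ioi_mem_nhds hy.1] with z hz
      exact besselIRep_zero_eq_rpowSeries hν0 (le_of_lt hz)
    · refine ContinuousOn.intervalIntegrable ?_
      rw [Set.uIcc_of_le hy.1.le]
      exact (hc 0).mono (Set.Icc_subset_Icc_right hy.2.le)
    · exact ((hc 0).mono Set.Ioo_subset_Icc_self).stronglyMeasurableAtFilter isOpen_Ioo y hy
    · exact (hc 0).continuousAt (Icc_mem_nhds hy.1 hy.2)
  have hmono : StrictMonoOn (fun y => besselIRep ν 0 0 y - besselIRep ν 0 1 y)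
      (Set.Icc 0 x) := by
    refine strictMonoOn_of_deriv_pos (convex_Icc 0 x) ((hc 0).sub (hc 1)) ?_
    rw [interior_Icc]
    intro y hy
    rw [(hderiv y hy).deriv, besselIRep_zero_eq_rpowSeries hν0 hy.1.le]
    exact sub_pos.2 (rpowSeries_besselCoeff_lt_deriv hν hy.1)
  have h := hmono (Set.left_mem_Icc.2 hx.le) (Set.right_mem_Icc.2 hx.le) hx
  have h00 : besselIRep ν 0 0 0 = 0 := by simp [besselIRep, Real.zero_rpow hν0.ne']
  have h10 : besselIRep ν 0 1 0 = 0 := by simp [besselIRep]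
  simp only [h00, h10, sub_zero] at h
  exact sub_pos.1 h

theorem besselIRep_succ_lt (ν : ℝ) (hν : 1 / 2 ≤ ν) (n : ℕ) (x : ℝ) (hx : 0 < x) :
    besselIRep ν 0 (n + 1) x < besselIRep ν 0 n x := by
  have hν0 : 0 < ν := by linarith
  induction n generalizing x with
  | zero => exact besselIRep_one_lt hν hx
  | succ n ih =>
    exact intervalIntegral.integral_lt_integral_of_continuousOn_of_le_of_exists_lt hx
      (continuousOn_besselIRep hν0 (n + 1) hx) (continuousOn_besselIRep hν0 n hx)
      (fun y hy => (ih y hy.1).le) ⟨x, Set.right_mem_Icc.2 hx.le, ih x hx⟩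
end

section
/- For all real ν > 1/2 and all real α > 1, the equation K_ν(x) = α K_{ν-1}(x) has exactly one root x in the region x > 0. -/
open Real MeasureTheory

/-- The modified Bessel function of the second kind
`K_ν(x) = ∫_0^∞ e^{-x cosh t} cosh(ν t) dt`. -/
noncomputable def besselK (ν x : ℝ) : ℝ :=
  ∫ t in Set.Ioi (0 : ℝ), Real.exp (-x * Real.cosh t) * Real.cosh (ν * t)

open Set Filter Topology

lemma integrableOn_exp_neg_mul_cosh_mul_cosh (ν : ℝ) {x : ℝ} (hx : 0 < x) :
    IntegrableOn (fun t => exp (-x * cosh t) * cosh (ν * t)) (Ioi 0) := by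
  refine integrable_of_isBigO_exp_neg (b := 1) one_pos (by fun_prop) ?_
  refine Asymptotics.IsBigO.of_bound (exp ((|ν| + 1) ^ 2 / x)) ?_
  filter_upwards [eventually_ge_atTop 0] with t ht
  have hcosh : t ^ 2 / 4 ≤ cosh t := by
    rw [cosh_eq]
    nlinarith [quadratic_le_exp_of_nonneg ht, exp_pos (-t)]
  have hν : cosh (ν * t) ≤ exp (|ν| * t) := by
    rw [← cosh_abs, abs_mul, abs_of_nonneg ht, cosh_eq]
    have : exp (-(|ν| * t)) ≤ exp (|ν| * t) :=
      exp_le_exp.2 (by linarith [mul_nonneg (abs_nonneg ν) ht])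
    linarith
  rw [norm_of_nonneg (by positivity), norm_of_nonneg (by positivity), ← exp_add]
  refine (mul_le_mul_of_nonneg_left hν (exp_pos _).le).trans ?_
  rw [← exp_add, exp_le_exp]
  have h1 : x * (t ^ 2 / 4) ≤ x * cosh t := by gcongr
  have h2 : (|ν| + 1) * t ≤ (|ν| + 1) ^ 2 / x + x * (t ^ 2 / 4) := by
    have : (|ν| + 1) ^ 2 / x + x * (t ^ 2 / 4) - (|ν| + 1) * t
        = ((|ν| + 1) - x * t / 2) ^ 2 / x := by field_simp; ring
    have : 0 ≤ ((|ν| + 1) - x * t / 2) ^ 2 / x := by positivity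
    linarith
  linarith

lemma cosh_mul_cosh_sub_one_lt {ν s t : ℝ} (hν : 1 / 2 < ν) (hs : 0 ≤ s) (hst : s < t) :
    cosh (ν * s) * cosh ((ν - 1) * t) < cosh (ν * t) * cosh ((ν - 1) * s) := by
  have prod (a b : ℝ) : 2 * (cosh a * cosh b) = cosh (a + b) + cosh (a - b) := by
    rw [cosh_add, cosh_sub]; ring
  have key {a b : ℝ} (ha : 0 < a) (hb : 0 < b) : cosh (a - b) < cosh (a + b) := by
    rw [cosh_lt_cosh, abs_of_pos (add_pos ha hb), abs_lt]
    constructor <;> linarith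
  have h1 := key (a := (2 * ν - 1) * (s + t) / 2) (b := (t - s) / 2)
    (by have : 0 < (2 * ν - 1) * (s + t) := mul_pos (by linarith) (by linarith)
        linarith) (by linarith)
  have h2 := key (a := (s + t) / 2) (b := (2 * ν - 1) * (t - s) / 2) (by linarith)
    (by have : 0 < (2 * ν - 1) * (t - s) := mul_pos (by linarith) (by linarith)
        linarith)
  have e1 := prod (ν * s) ((ν - 1) * t)
  have e2 := prod (ν * t) ((ν - 1) * s)
  ring_nf at h1 h2 e1 e2 ⊢
  linarith

lemma exists_forall_one_le_cosh_sub {ν α : ℝ} (hν : 1 / 2 < ν) (hα : 1 < α) :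
    ∃ T, 0 < T ∧ ∀ t, T ≤ t → 1 ≤ cosh (ν * t) - α * cosh ((ν - 1) * t) := by
  have hμ : 0 < ν - |ν - 1| := by
    have : |ν - 1| < ν := abs_lt.2 ⟨by linarith, by linarith⟩
    linarith
  refine ⟨2 * (α + 1) / (ν - |ν - 1|), by positivity, fun t ht => ?_⟩
  have ht0 : 0 < t := lt_of_lt_of_le (by positivity) ht
  rw [div_le_iff₀ hμ] at ht
  have h1 : exp (ν * t) / 2 ≤ cosh (ν * t) := by
    rw [cosh_eq]; linarith [exp_pos (-(ν * t))]
  have h0 : 0 ≤ |ν - 1| * t := by positivity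
  have h2 : cosh ((ν - 1) * t) ≤ exp (|ν - 1| * t) := by
    rw [← cosh_abs, abs_mul, abs_of_pos ht0, cosh_eq]
    have : exp (-(|ν - 1| * t)) ≤ exp (|ν - 1| * t) := exp_le_exp.2 (by linarith)
    linarith
  have h3 : 2 * (α + 1) ≤ exp ((ν - |ν - 1|) * t) := by
    linarith [add_one_le_exp ((ν - |ν - 1|) * t)]
  have h4 : exp (ν * t) = exp (|ν - 1| * t) * exp ((ν - |ν - 1|) * t) := by
    rw [← exp_add]; ring_nf
  have h5 : 1 ≤ exp (|ν - 1| * t) := one_le_exp h0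
  have h6 : α * cosh ((ν - 1) * t) ≤ α * exp (|ν - 1| * t) := by gcongr
  nlinarith

lemma exists_sign_change_cosh_sub {ν α : ℝ} (hν : 1 / 2 < ν) (hα : 1 < α) :
    ∃ t₀, 0 < t₀ ∧ (∀ t, 0 ≤ t → t < t₀ → cosh (ν * t) - α * cosh ((ν - 1) * t) < 0) ∧
      ∀ t, t₀ < t → 0 < cosh (ν * t) - α * cosh ((ν - 1) * t) := by
  obtain ⟨T, hT, hT1⟩ := exists_forall_one_le_cosh_sub hν hα
  obtain ⟨t₀, ht₀, h0⟩ := intermediate_value_Icc hT.le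
    (f := fun t => cosh (ν * t) - α * cosh ((ν - 1) * t)) (by fun_prop)
    (show (0 : ℝ) ∈ _ from ⟨by simp; linarith, by linarith [hT1 T le_rfl]⟩)
  have h0' : cosh (ν * t₀) = α * cosh ((ν - 1) * t₀) := by simpa [sub_eq_zero] using h0
  have hpos : 0 < t₀ := by
    refine ht₀.1.lt_of_ne fun h => ?_
    simp [← h] at h0'
    linarith
  have hc : 0 < cosh ((ν - 1) * t₀) := cosh_pos _
  refine ⟨t₀, hpos, fun t ht htt => ?_, fun t htt => ?_⟩
  · have := cosh_mul_cosh_sub_one_lt hν ht htt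
    rw [h0'] at this
    nlinarith
  · have := cosh_mul_cosh_sub_one_lt hν hpos.le htt
    rw [h0'] at this
    nlinarith

section SignChange

variable {g : ℝ → ℝ}

lemma integral_exp_neg_mul_cosh_neg_of_eq_zero {t₀ x y : ℝ} (ht₀ : 0 < t₀)
    (hneg : ∀ t, 0 ≤ t → t < t₀ → g t < 0) (hpos : ∀ t, t₀ < t → 0 < g t)
    (hint : ∀ x, 0 < x → IntegrableOn (fun t => exp (-x * cosh t) * g t) (Ioi 0))
    (hx : 0 < x) (hxy : x < y) (h0 : ∫ t in Ioi (0 : ℝ), exp (-x * cosh t) * g t = 0) :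
    ∫ t in Ioi (0 : ℝ), exp (-y * cosh t) * g t < 0 := by
  set c := exp (-(y - x) * cosh t₀)
  have hi : IntegrableOn
      (fun t => c * (exp (-x * cosh t) * g t) - exp (-y * cosh t) * g t) (Ioi 0) :=
    ((hint x hx).const_mul c).sub (hint y (hx.trans hxy))
  have heq : ∫ t in Ioi (0 : ℝ), (c * (exp (-x * cosh t) * g t) - exp (-y * cosh t) * g t)
      = - ∫ t in Ioi (0 : ℝ), exp (-y * cosh t) * g t := by
    rw [integral_sub ((hint x hx).const_mul c) (hint y (hx.trans hxy)), integral_const_mul, h0]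
    ring
  have hfact (t : ℝ) : c * (exp (-x * cosh t) * g t) - exp (-y * cosh t) * g t
      = exp (-x * cosh t) * ((c - exp (-(y - x) * cosh t)) * g t) := by
    have : exp (-y * cosh t) = exp (-x * cosh t) * exp (-(y - x) * cosh t) := by
      rw [← exp_add]; ring_nf
    rw [this]; ring
  have hp : ∀ t, 0 < t → t ≠ t₀ →
      0 < c * (exp (-x * cosh t) * g t) - exp (-y * cosh t) * g t := by
    intro t ht hne
    rw [hfact]
    refine mul_pos (exp_pos _) ?_
    rcases lt_or_gt_of_ne hne with h | h
    · have : cosh t < cosh t₀ := by rwa [cosh_lt_cosh, abs_of_pos ht, abs_of_pos ht₀]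
      refine mul_pos_of_neg_of_neg (sub_neg.2 (exp_lt_exp.2 ?_)) (hneg t ht.le h)
      nlinarith
    · have : cosh t₀ < cosh t := by rwa [cosh_lt_cosh, abs_of_pos ht, abs_of_pos ht₀]
      refine mul_pos (sub_pos.2 (exp_lt_exp.2 ?_)) (hpos t h)
      nlinarith
  have : 0 < ∫ t in Ioi (0 : ℝ), (c * (exp (-x * cosh t) * g t) - exp (-y * cosh t) * g t) := by
    rw [setIntegral_pos_iff_support_of_nonneg_ae _ hi]
    · refine lt_of_lt_of_le ?_ (measure_mono (s := Ioo 0 t₀) ?_)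
      · simpa using ht₀
      · exact fun t ht => ⟨(hp t ht.1 ht.2.ne).ne', ht.1⟩
    · filter_upwards [ae_restrict_mem measurableSet_Ioi] with t ht
      by_cases h : t = t₀
      · rw [hfact, h]; simp [c]
      · exact (hp t ht h).le
  linarith

lemma continuousOn_integral_exp_neg_mul_cosh (hg : Continuous g)
    (hint : ∀ x, 0 < x → IntegrableOn (fun t => exp (-x * cosh t) * g t) (Ioi 0)) :
    ContinuousOn (fun x => ∫ t in Ioi (0 : ℝ), exp (-x * cosh t) * g t) (Ioi 0) := by
  intro x hx
  have hx : 0 < x := hx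
  refine ContinuousAt.continuousWithinAt (continuousAt_of_dominated
    (bound := fun t => ‖exp (-(x / 2) * cosh t) * g t‖) ?_ ?_ (hint _ (half_pos hx)).norm ?_)
  · exact Eventually.of_forall fun y => by fun_prop
  · filter_upwards [eventually_gt_nhds (half_lt_self hx)] with y hy
    refine Eventually.of_forall fun t => ?_
    rw [norm_mul, norm_mul, norm_of_nonneg (exp_pos _).le, norm_of_nonneg (exp_pos _).le]
    have := cosh_pos t
    gcongr
  · exact Eventually.of_forall fun t => by fun_prop

lemma exists_integral_exp_neg_mul_cosh_neg {t₀ : ℝ} (ht₀ : 0 < t₀)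
    (hneg : ∀ t, 0 ≤ t → t < t₀ → g t < 0)
    (hint : ∀ x, 0 < x → IntegrableOn (fun t => exp (-x * cosh t) * g t) (Ioi 0)) :
    ∃ y, 0 < y ∧ ∫ t in Ioi (0 : ℝ), exp (-y * cosh t) * g t < 0 := by
  set h : ℝ → ℝ := fun t => exp (-1 * cosh t) * g t
  have hh : IntegrableOn h (Ioi 0) := hint 1 one_pos
  set t₁ := t₀ / 2
  have ht₁ : 0 < t₁ := half_pos ht₀
  have ht₁₀ : t₁ < t₀ := half_lt_self ht₀
  have hsub : Ioc 0 t₁ ⊆ Ioi 0 := Ioc_subset_Ioi_self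
  have hA : ∫ t in Ioc 0 t₁, h t < 0 := by
    have : 0 < ∫ t in Ioc 0 t₁, -h t := by
      have hp : ∀ t ∈ Ioc 0 t₁, 0 < -h t := fun t ht =>
        neg_pos.2 (mul_neg_of_pos_of_neg (exp_pos _) (hneg t ht.1.le (ht.2.trans_lt ht₁₀)))
      have hi : IntegrableOn (fun t => -h t) (Ioc 0 t₁) := (hh.mono_set hsub).neg
      rw [setIntegral_pos_iff_support_of_nonneg_ae _ hi]
      · refine lt_of_lt_of_le ?_ (measure_mono (s := Ioc 0 t₁) ?_)
        · simpa using ht₁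
        · exact fun t ht => ⟨(hp t ht).ne', ht⟩
      · filter_upwards [ae_restrict_mem measurableSet_Ioc] with t ht using (hp t ht).le
    rw [integral_neg] at this
    linarith
  have hd : 0 < cosh t₀ - cosh t₁ := by
    rw [sub_pos, cosh_lt_cosh, abs_of_pos ht₁, abs_of_pos ht₀]; exact ht₁₀
  have hlim : Tendsto (fun z => exp (-(z * (cosh t₀ - cosh t₁))) * ∫ t in Ioi (0 : ℝ), ‖h t‖)
      atTop (𝓝 (0 * ∫ t in Ioi (0 : ℝ), ‖h t‖)) :=
    (tendsto_exp_neg_atTop_nhds_zero.comp (tendsto_id.atTop_mul_const hd)).mul_const _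
  rw [zero_mul] at hlim
  obtain ⟨z, hz, hz0⟩ := ((hlim.eventually_lt_const (neg_pos.2 hA)).and
    (eventually_gt_atTop 0)).exists
  have hy : 0 < z + 1 := by linarith
  refine ⟨z + 1, hy, ?_⟩
  have hle : ∫ t in Ioi (0 : ℝ), exp (z * cosh t₁) * (exp (-(z + 1) * cosh t) * g t)
      ≤ ∫ t in Ioi (0 : ℝ),
        ((Ioc 0 t₁).indicator h t + exp (-(z * (cosh t₀ - cosh t₁))) * ‖h t‖) := by
    have hind : IntegrableOn ((Ioc 0 t₁).indicator h) (Ioi 0) :=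
      hh.indicator measurableSet_Ioc
    refine setIntegral_mono_on ((hint _ hy).const_mul _) (hind.add (hh.norm.const_mul _))
      measurableSet_Ioi fun t ht => ?_
    have ht : 0 < t := ht
    have e : exp (z * cosh t₁) * (exp (-(z + 1) * cosh t) * g t)
        = exp (-(z * (cosh t - cosh t₁))) * h t := by
      simp only [h, ← mul_assoc, ← exp_add]; ring_nf
    rw [e]
    have hn : 0 ≤ exp (-(z * (cosh t₀ - cosh t₁))) * ‖h t‖ := by positivity
    have hs : t < t₀ → h t < 0 := fun H =>
      mul_neg_of_pos_of_neg (exp_pos _) (hneg t ht.le H)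
    rcases le_or_gt t t₁ with h1 | h1
    · rw [indicator_of_mem (show t ∈ Ioc 0 t₁ from ⟨ht, h1⟩)]
      have : cosh t ≤ cosh t₁ := by rwa [cosh_le_cosh, abs_of_pos ht, abs_of_pos ht₁]
      have : 1 ≤ exp (-(z * (cosh t - cosh t₁))) := one_le_exp (by nlinarith)
      nlinarith [hs (h1.trans_lt ht₁₀)]
    · rw [indicator_of_notMem (fun H => h1.not_ge H.2), zero_add]
      rcases lt_or_ge t t₀ with h2 | h2
      · exact (mul_neg_of_pos_of_neg (exp_pos _) (hs h2)).le.trans hn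
      · have : cosh t₀ ≤ cosh t := by rwa [cosh_le_cosh, abs_of_pos ht, abs_of_pos ht₀]
        refine (mul_le_mul_of_nonneg_left (le_norm_self _) (exp_pos _).le).trans
          (mul_le_mul_of_nonneg_right (exp_le_exp.2 ?_) (norm_nonneg _))
        nlinarith
  rw [integral_const_mul, integral_add (hh.indicator measurableSet_Ioc) (hh.norm.const_mul _),
    integral_const_mul, setIntegral_indicator measurableSet_Ioc,
    inter_eq_right.2 hsub] at hle
  by_contra! hcon
  have := mul_nonneg (exp_pos (z * cosh t₁)).le hcon
  linarith

lemma exists_integral_exp_neg_mul_cosh_pos (hg : Continuous g) {T : ℝ} (hT : 0 < T)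
    (hge : ∀ t, T ≤ t → 1 ≤ g t)
    (hint : ∀ x, 0 < x → IntegrableOn (fun t => exp (-x * cosh t) * g t) (Ioi 0)) :
    ∃ x, 0 < x ∧ 0 < ∫ t in Ioi (0 : ℝ), exp (-x * cosh t) * g t := by
  set U := T + |∫ t in (0 : ℝ)..T, g t| + 1
  have hTU : T ≤ U := by linarith [abs_nonneg (∫ t in (0 : ℝ)..T, g t)]
  have hG : Continuous fun x => ∫ t in (0 : ℝ)..U, exp (-x * cosh t) * g t :=
    intervalIntegral.continuous_parametric_intervalIntegral_of_continuous' (by fun_prop) _ _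
  have hG0 : 0 < ∫ t in (0 : ℝ)..U, exp (-0 * cosh t) * g t := by
    simp only [neg_zero, zero_mul, exp_zero, one_mul]
    rw [← intervalIntegral.integral_add_adjacent_intervals (hg.intervalIntegrable 0 T)
      (hg.intervalIntegrable T U)]
    have : ∫ t in T..U, (1 : ℝ) ≤ ∫ t in T..U, g t :=
      intervalIntegral.integral_mono_on hTU (by simp) (hg.intervalIntegrable T U)
        fun t ht => hge t ht.1
    rw [intervalIntegral.integral_const, smul_eq_mul, mul_one] at this
    linarith [neg_abs_le (∫ t in (0 : ℝ)..T, g t)]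
  have hev : ∀ᶠ x in 𝓝[>] (0 : ℝ), 0 < ∫ t in (0 : ℝ)..U, exp (-x * cosh t) * g t :=
    (hG.continuousAt.eventually (lt_mem_nhds hG0)).filter_mono nhdsWithin_le_nhds
  obtain ⟨x, hx, hx0⟩ := (hev.and self_mem_nhdsWithin).exists
  have hx0 : 0 < x := hx0
  refine ⟨x, hx0, ?_⟩
  have hU : 0 ≤ U := hT.le.trans hTU
  rw [← Ioc_union_Ioi_eq_Ioi hU, setIntegral_union (Ioc_disjoint_Ioi le_rfl) measurableSet_Ioi
    ((hint x hx0).mono_set Ioc_subset_Ioi_self) ((hint x hx0).mono_set (Ioi_subset_Ioi hU)),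
    ← intervalIntegral.integral_of_le hU]
  refine add_pos_of_pos_of_nonneg hx (setIntegral_nonneg measurableSet_Ioi fun t ht => ?_)
  exact mul_nonneg (exp_pos _).le (zero_le_one.trans (hge t (hTU.trans (le_of_lt ht))))

end SignChange

theorem besselK_eq_mul_besselK_unique_root (ν α : ℝ) (hν : 1 / 2 < ν) (hα : 1 < α) :
    ∃! x : ℝ, 0 < x ∧ besselK ν x = α * besselK (ν - 1) x := by
  set g : ℝ → ℝ := fun t => cosh (ν * t) - α * cosh ((ν - 1) * t) with hgdef
  have hg : Continuous g := by fun_prop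
  have hexpand (x t : ℝ) : exp (-x * cosh t) * g t = exp (-x * cosh t) * cosh (ν * t)
      - α * (exp (-x * cosh t) * cosh ((ν - 1) * t)) := by
    simp only [hgdef]; ring
  have hint : ∀ x, 0 < x → IntegrableOn (fun t => exp (-x * cosh t) * g t) (Ioi 0) := by
    intro x hx
    simp only [hexpand]
    exact (integrableOn_exp_neg_mul_cosh_mul_cosh ν hx).sub
      ((integrableOn_exp_neg_mul_cosh_mul_cosh (ν - 1) hx).const_mul α)
  have hiff : ∀ x, 0 < x → (besselK ν x = α * besselK (ν - 1) x ↔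
      ∫ t in Ioi (0 : ℝ), exp (-x * cosh t) * g t = 0) := by
    intro x hx
    simp only [hexpand]
    rw [integral_sub (integrableOn_exp_neg_mul_cosh_mul_cosh ν hx)
      ((integrableOn_exp_neg_mul_cosh_mul_cosh (ν - 1) hx).const_mul α), integral_const_mul,
      sub_eq_zero, besselK, besselK]
  obtain ⟨t₀, ht₀, hneg, hpos⟩ := exists_sign_change_cosh_sub hν hα
  obtain ⟨T, hT, hge⟩ := exists_forall_one_le_cosh_sub hν hα
  obtain ⟨a, ha, hFa⟩ := exists_integral_exp_neg_mul_cosh_pos hg hT hge hint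
  obtain ⟨b, hb, hFb⟩ := exists_integral_exp_neg_mul_cosh_neg ht₀ hneg hint
  obtain ⟨x, hx, hFx⟩ := isPreconnected_Ioi.intermediate_value (mem_Ioi.2 hb) (mem_Ioi.2 ha)
    (continuousOn_integral_exp_neg_mul_cosh hg hint) ⟨hFb.le, hFa.le⟩
  have hx : 0 < x := hx
  refine ⟨x, ⟨hx, (hiff x hx).2 hFx⟩, fun y ⟨hy, hFy⟩ => ?_⟩
  rw [hiff y hy] at hFy
  rcases lt_trichotomy y x with h | h | h
  · exact absurd hFx
      (integral_exp_neg_mul_cosh_neg_of_eq_zero ht₀ hneg hpos hint hy h hFy).ne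
  · exact h
  · exact absurd hFy
      (integral_exp_neg_mul_cosh_neg_of_eq_zero ht₀ hneg hpos hint hx h hFx).ne
end

section
/- For every real ν and all x > 0, ∫_x^∞ t^ν K_ν(t) dt < x^ν K_{ν+1}(x). -/
open Real MeasureTheory

lemma abs_cosh_mul_le_exp (μ : ℝ) {t : ℝ} (ht : 0 ≤ t) : |cosh (μ * t)| ≤ exp (|μ| * t) := by
  rw [abs_of_pos (cosh_pos _), ← cosh_abs, abs_mul, abs_of_nonneg ht, ← cosh_add_sinh]
  linarith [sinh_nonneg_iff.2 (mul_nonneg (abs_nonneg μ) ht)]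

lemma abs_sinh_mul_le_exp (μ : ℝ) {t : ℝ} (ht : 0 ≤ t) : |sinh (μ * t)| ≤ exp (|μ| * t) := by
  rw [abs_sinh, abs_mul, abs_of_nonneg ht, ← cosh_add_sinh]
  linarith [cosh_pos (|μ| * t)]

lemma sq_div_two_le_cosh (t : ℝ) : t ^ 2 / 2 ≤ cosh t := by
  have h2 := cosh_sq (t / 2)
  have h3 := cosh_two_mul (t / 2)
  have h4 : (t / 2) ^ 2 ≤ sinh (t / 2) ^ 2 := by
    rw [sq_le_sq, abs_sinh]
    exact self_le_sinh_iff.2 (abs_nonneg _)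
  rw [show 2 * (t / 2) = t by ring] at h3
  linarith

lemma exp_neg_mul_cosh_mul_exp_le {x : ℝ} (hx : 0 < x) (a t : ℝ) :
    exp (-x * cosh t) * exp (a * t) ≤ exp ((a + 1) ^ 2 / (2 * x)) * exp (-1 * t) := by
  rw [← exp_add, ← exp_add, exp_le_exp]
  have h := mul_le_mul_of_nonneg_left (sq_div_two_le_cosh t) hx.le
  have h2 : (a + 1) * t - x * (t ^ 2 / 2) ≤ (a + 1) ^ 2 / (2 * x) := by
    rw [le_div_iff₀ (by positivity)]
    nlinarith [sq_nonneg (a + 1 - x * t)]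
  linarith

lemma norm_exp_neg_mul_cosh_mul_le {x a t : ℝ} (hx : 0 < x) {h : ℝ → ℝ}
    (ht : |h t| ≤ exp (a * t)) :
    ‖exp (-x * cosh t) * h t‖ ≤ exp ((a + 1) ^ 2 / (2 * x)) * exp (-1 * t) := by
  rw [norm_mul, norm_of_nonneg (exp_pos _).le, norm_eq_abs]
  exact (mul_le_mul_of_nonneg_left ht (exp_pos _).le).trans (exp_neg_mul_cosh_mul_exp_le hx a t)

lemma integrableOn_exp_neg_mul_cosh_mul {x : ℝ} (hx : 0 < x) (a : ℝ) {h : ℝ → ℝ}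
    (hc : Continuous h) (hh : ∀ t, 0 ≤ t → |h t| ≤ exp (a * t)) :
    IntegrableOn (fun t => exp (-x * cosh t) * h t) (Set.Ioi 0) := by
  refine integrable_of_isBigO_exp_neg (b := 1) one_pos (by fun_prop) ?_
  refine Asymptotics.IsBigO.of_bound (exp ((a + 1) ^ 2 / (2 * x))) ?_
  filter_upwards [Filter.eventually_ge_atTop 0] with t ht
  rw [norm_of_nonneg (exp_pos (-1 * t)).le]
  exact norm_exp_neg_mul_cosh_mul_le hx (hh t ht)

lemma integrableOn_besselK {x : ℝ} (hx : 0 < x) (μ : ℝ) :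
    IntegrableOn (fun t => exp (-x * cosh t) * cosh (μ * t)) (Set.Ioi 0) :=
  integrableOn_exp_neg_mul_cosh_mul hx |μ| (by fun_prop) fun _ ht => abs_cosh_mul_le_exp μ ht

lemma integrableOn_besselK_deriv {x : ℝ} (hx : 0 < x) (μ : ℝ) :
    IntegrableOn (fun t => exp (-x * cosh t) * (cosh t * cosh (μ * t))) (Set.Ioi 0) := by
  refine integrableOn_exp_neg_mul_cosh_mul hx (1 + |μ|) (by fun_prop) fun t ht => ?_
  rw [abs_mul, add_mul, exp_add]
  have := abs_cosh_mul_le_exp 1 ht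
  simp only [abs_one, one_mul] at this ⊢
  exact mul_le_mul this (abs_cosh_mul_le_exp μ ht) (abs_nonneg _) (exp_pos _).le

lemma besselK_pos (μ : ℝ) {x : ℝ} (hx : 0 < x) : 0 < besselK μ x := by
  have hpos : ∀ t, 0 < exp (-x * cosh t) * cosh (μ * t) :=
    fun t => mul_pos (exp_pos _) (cosh_pos _)
  rw [besselK, integral_pos_iff_support_of_nonneg (fun t => (hpos t).le)
    (integrableOn_besselK hx μ)]
  have : Function.support (fun t => exp (-x * cosh t) * cosh (μ * t)) = Set.univ :=
    Set.eq_univ_of_forall fun t => (hpos t).ne'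
  rw [this]
  simp

/-- Differentiation of `besselK` under the integral sign. -/
lemma hasDerivAt_besselK_integral (μ : ℝ) {x : ℝ} (hx : 0 < x) :
    HasDerivAt (besselK μ)
      (∫ t in Set.Ioi (0 : ℝ), -(exp (-x * cosh t) * (cosh t * cosh (μ * t)))) x := by
  refine (hasDerivAt_integral_of_dominated_loc_of_deriv_le
    (F := fun y t => exp (-y * cosh t) * cosh (μ * t))
    (F' := fun y t => -(exp (-y * cosh t) * (cosh t * cosh (μ * t))))
    (bound := fun t => exp (-(x / 2) * cosh t) * (cosh t * cosh (μ * t)))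
    (s := Set.Ioi (x / 2)) (Ioi_mem_nhds (by linarith)) ?_ (integrableOn_besselK hx μ) ?_ ?_
    (integrableOn_besselK_deriv (half_pos hx) μ) ?_).2
  · exact Filter.Eventually.of_forall fun y =>
      Continuous.aestronglyMeasurable (by fun_prop)
  · exact Continuous.aestronglyMeasurable (by fun_prop)
  · refine Filter.Eventually.of_forall fun t y hy => ?_
    have hc := cosh_pos t
    have hm := cosh_pos (μ * t)
    rw [norm_neg, norm_of_nonneg (by positivity)]
    have : x / 2 < y := hy
    gcongr
  · refine Filter.Eventually.of_forall fun t y _ => ?_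
    have h := (((hasDerivAt_id y).neg.mul_const (cosh t)).exp).mul_const (cosh (μ * t))
    refine h.congr_deriv ?_
    simp only [Pi.neg_apply, id]
    ring

lemma integral_exp_neg_mul_cosh_mul_sinh_mul_sinh (μ : ℝ) {x : ℝ} (hx : 0 < x) :
    IntegrableOn (fun t => exp (-x * cosh t) * (sinh t * sinh (μ * t))) (Set.Ioi 0) ∧
    x * ∫ t in Set.Ioi (0 : ℝ), exp (-x * cosh t) * (sinh t * sinh (μ * t)) =
      μ * besselK μ x := by
  have hint : IntegrableOn (fun t => exp (-x * cosh t) * (sinh t * sinh (μ * t)))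
      (Set.Ioi 0) := by
    refine integrableOn_exp_neg_mul_cosh_mul hx (1 + |μ|) (by fun_prop) fun t ht => ?_
    rw [abs_mul, add_mul, exp_add]
    have := abs_sinh_mul_le_exp 1 ht
    simp only [abs_one, one_mul] at this ⊢
    exact mul_le_mul this (abs_sinh_mul_le_exp μ ht) (abs_nonneg _) (exp_pos _).le
  refine ⟨hint, ?_⟩
  have hd : ∀ t ∈ Set.Ici (0 : ℝ), HasDerivAt (fun t => exp (-x * cosh t) * sinh (μ * t))
      (μ * (exp (-x * cosh t) * cosh (μ * t)) -
        x * (exp (-x * cosh t) * (sinh t * sinh (μ * t)))) t := by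
    intro t _
    have h := (((hasDerivAt_cosh t).const_mul (-x)).exp).mul
      (((hasDerivAt_id t).const_mul μ).sinh)
    refine h.congr_deriv ?_
    simp only [id]
    ring
  have hlim : Filter.Tendsto (fun t => exp (-x * cosh t) * sinh (μ * t)) Filter.atTop
      (nhds 0) := by
    have h0 : Filter.Tendsto (fun t : ℝ => exp ((|μ| + 1) ^ 2 / (2 * x)) * exp (-1 * t))
        Filter.atTop (nhds 0) := by
      simpa using (tendsto_exp_neg_atTop_nhds_zero.const_mul (exp ((|μ| + 1) ^ 2 / (2 * x))))
    refine squeeze_zero_norm' ?_ h0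
    filter_upwards [Filter.eventually_ge_atTop 0] with t ht
    exact norm_exp_neg_mul_cosh_mul_le (h := fun t => sinh (μ * t)) hx (abs_sinh_mul_le_exp μ ht)
  have hi1 := (integrableOn_besselK hx μ).const_mul μ
  have hi2 := hint.const_mul x
  have h := integral_Ioi_of_hasDerivAt_of_tendsto' hd (hi1.sub hi2) hlim
  rw [integral_sub hi1 hi2, integral_const_mul, integral_const_mul] at h
  simp only [mul_zero, sinh_zero, sub_zero] at h
  rw [besselK]
  linarith

/-- The recurrence `K_{ν+1}' = -K_ν - ((ν + 1) / x) K_{ν+1}`. -/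
lemma hasDerivAt_besselK_add_one (ν : ℝ) {x : ℝ} (hx : 0 < x) :
    HasDerivAt (besselK (ν + 1)) (-besselK ν x - (ν + 1) / x * besselK (ν + 1) x) x := by
  refine (hasDerivAt_besselK_integral (ν + 1) hx).congr_deriv ?_
  obtain ⟨hint, heq⟩ := integral_exp_neg_mul_cosh_mul_sinh_mul_sinh (ν + 1) hx
  have key : ∀ t, exp (-x * cosh t) * (cosh t * cosh ((ν + 1) * t)) =
      exp (-x * cosh t) * cosh (ν * t) +
        exp (-x * cosh t) * (sinh t * sinh ((ν + 1) * t)) := by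
    intro t
    have : ν * t = (ν + 1) * t - t := by ring
    rw [this, cosh_sub]
    ring
  rw [integral_neg]
  simp_rw [key]
  rw [integral_add (integrableOn_besselK hx ν) hint]
  change -(besselK ν x + _) = _
  rw [div_mul_eq_mul_div, ← heq]
  field_simp
  ring

lemma besselK_le_exp_mul (μ : ℝ) {x : ℝ} (hx : 1 ≤ x) :
    besselK μ x ≤ exp (1 - x) * besselK μ 1 := by
  rw [besselK, besselK, ← integral_const_mul]
  refine integral_mono (integrableOn_besselK (by linarith) μ)
    ((integrableOn_besselK one_pos μ).const_mul _) fun t => ?_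
  change exp (-x * cosh t) * cosh (μ * t) ≤ exp (1 - x) * (exp (-1 * cosh t) * cosh (μ * t))
  rw [← mul_assoc, ← exp_add]
  refine mul_le_mul_of_nonneg_right (exp_le_exp.2 ?_) (cosh_pos _).le
  nlinarith [one_le_cosh t]

lemma tendsto_rpow_mul_besselK_atTop (ν μ : ℝ) :
    Filter.Tendsto (fun x => x ^ ν * besselK μ x) Filter.atTop (nhds 0) := by
  have h0 : Filter.Tendsto (fun x : ℝ => exp 1 * besselK μ 1 * (x ^ ν * exp (-1 * x)))
      Filter.atTop (nhds 0) := by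
    simpa only [mul_zero] using (tendsto_rpow_mul_exp_neg_mul_atTop_nhds_zero ν 1 one_pos).const_mul
      (exp 1 * besselK μ 1)
  refine squeeze_zero' ?_ ?_ h0
  · filter_upwards [Filter.eventually_gt_atTop 0] with x hx
    exact (mul_pos (rpow_pos_of_pos hx ν) (besselK_pos μ hx)).le
  · filter_upwards [Filter.eventually_ge_atTop 1] with x hx
    have h := mul_le_mul_of_nonneg_left (besselK_le_exp_mul μ hx)
      (rpow_nonneg (zero_le_one.trans hx) ν)
    refine h.trans_eq ?_
    rw [show 1 - x = 1 + -1 * x by ring, exp_add]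
    ring

lemma hasDerivAt_rpow_mul_besselK_add_one (ν : ℝ) {x : ℝ} (hx : 0 < x) :
    HasDerivAt (fun t => t ^ ν * besselK (ν + 1) t)
      (-(x ^ ν * besselK ν x + x ^ (ν - 1) * besselK (ν + 1) x)) x := by
  refine ((hasDerivAt_rpow_const (p := ν) (Or.inl hx.ne')).mul
    (hasDerivAt_besselK_add_one ν hx)).congr_deriv ?_
  have : x ^ ν = x ^ (ν - 1) * x := by
    rw [← rpow_add_one hx.ne', sub_add_cancel]
  rw [this]
  field_simp
  ring

theorem integral_besselK_lt (ν : ℝ) (x : ℝ) (hx : 0 < x) :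
    (∫ t in Set.Ioi x, t ^ ν * besselK ν t) < x ^ ν * besselK (ν + 1) x := by
  have hpos : ∀ t ∈ Set.Ioi x, 0 < t ^ ν * besselK ν t := fun t ht =>
    mul_pos (rpow_pos_of_pos (hx.trans ht) ν) (besselK_pos ν (hx.trans ht))
  have hpos' : ∀ t ∈ Set.Ioi x, 0 < t ^ (ν - 1) * besselK (ν + 1) t := fun t ht =>
    mul_pos (rpow_pos_of_pos (hx.trans ht) _) (besselK_pos _ (hx.trans ht))
  have hd : ∀ t ∈ Set.Ici x, HasDerivAt (fun t => t ^ ν * besselK (ν + 1) t)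
      (-(t ^ ν * besselK ν t + t ^ (ν - 1) * besselK (ν + 1) t)) t := fun t ht =>
    hasDerivAt_rpow_mul_besselK_add_one ν (hx.trans_le ht)
  have hneg : ∀ t ∈ Set.Ioi x,
      -(t ^ ν * besselK ν t + t ^ (ν - 1) * besselK (ν + 1) t) ≤ 0 := fun t ht => by
    linarith [hpos t ht, hpos' t ht]
  have hlim := tendsto_rpow_mul_besselK_atTop ν (ν + 1)
  have hint := (integrableOn_Ioi_deriv_of_nonpos' hd hneg hlim).neg
  have heq := integral_Ioi_of_hasDerivAt_of_nonpos' hd hneg hlim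
  simp only [integral_neg, zero_sub, neg_inj] at heq
  by_cases hK : IntegrableOn (fun t => t ^ ν * besselK ν t) (Set.Ioi x)
  · have hK' : IntegrableOn (fun t => t ^ (ν - 1) * besselK (ν + 1) t) (Set.Ioi x) := by
      refine (hint.sub hK).congr (Filter.Eventually.of_forall fun t => ?_)
      simp
    have hgt : 0 < ∫ t in Set.Ioi x, t ^ (ν - 1) * besselK (ν + 1) t := by
      rw [setIntegral_pos_iff_support_of_nonneg_ae
        (ae_restrict_of_forall_mem measurableSet_Ioi fun t ht => (hpos' t ht).le) hK',
        Set.inter_eq_self_of_subset_right (s := Function.support _)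
          fun t ht => (hpos' t ht).ne']
      simp
    rw [integral_add hK hK'] at heq
    linarith
  · rw [integral_undef hK]
    exact mul_pos (rpow_pos_of_pos hx ν) (besselK_pos _ hx)
end
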